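/- If there exists a secure equilibrium with cost profile (a_i)_{i∈Π} in a multiplayer quantitative reachability game (G, v₀), then there exists a goal-optimal and dev-optimal secure equilibrium with some cost profile (b_i)_{i∈Π} in (G, v₀) such that b_i ≤ a_i for every player i ∈ Π. -/

import Mathlib

open scoped Classical ENat

/-- A multiplayer quantitative reachability game: a finite directed graph whose
vertices are partitioned among the players (via `owner`), every vertex has an
outgoing edge, and each player `i` has a nonempty goal set `F i`. -/
structure QRGame (ι V : Type) where
  owner : V → ι
  E : V → V → Prop
  total : ∀ v, ∃ w, E v w
  F : ι → Set V
  F_ne : ∀ i, (F i).Nonempty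

namespace QRGame

variable {ι V : Type}

/-- Histories are encoded as *reversed* nonempty lists: the head is the current
vertex, the last element is the initial vertex `v₀`, and consecutive elements
are joined by edges of the graph. -/
def IsHist (G : QRGame ι V) (v₀ : V) : List V → Prop
  | [] => False
  | [v] => v = v₀
  | v :: w :: t => G.E w v ∧ IsHist G v₀ (w :: t)

/-- The current (i.e. most recent) vertex of a history. -/
def cur (v₀ : V) (h : List V) : V := h.headD v₀

/-- `σ` is a valid strategy of player `i`: on every history whose current
vertex belongs to player `i`, it chooses a successor along an edge. -/
def IsStrat (G : QRGame ι V) (v₀ : V) (i : ι) (σ : List V → V) : Prop :=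
  ∀ h : List V, G.IsHist v₀ h → G.owner (cur v₀ h) = i → G.E (cur v₀ h) (σ h)

/-- A strategy profile: one valid strategy for each player. -/
def IsProfile (G : QRGame ι V) (v₀ : V) (σ : ι → List V → V) : Prop :=
  ∀ i, G.IsStrat v₀ i (σ i)

/-- The history reached after `n` further steps when all players follow the
profile `σ` from the history `h` on. -/
def histFrom (G : QRGame ι V) (v₀ : V) (σ : ι → List V → V) (h : List V) : ℕ → List V
  | 0 => h
  | n + 1 =>
      σ (G.owner (cur v₀ (histFrom G v₀ σ h n))) (histFrom G v₀ σ h n)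
        :: histFrom G v₀ σ h n

/-- The full play (indexed from time `0`) whose prefix is the history `h` and
which is consistent with the profile `σ` after `h`. -/
def fullPlay (G : QRGame ι V) (v₀ : V) (σ : ι → List V → V) (h : List V) (t : ℕ) : V :=
  (G.histFrom v₀ σ h t).reverse.getD t v₀

/-- The outcome `⟨(σ_i)⟩_{v₀}` of the profile `σ` from the initial vertex. -/
def outcome (G : QRGame ι V) (v₀ : V) (σ : ι → List V → V) : ℕ → V :=
  G.fullPlay v₀ σ [v₀]

/-- Cost of player `i` for a play `ρ`: the least `l` with `ρ l ∈ F i`,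
and `⊤` (i.e. `+∞`) if there is no such `l`. -/
noncomputable def cost (G : QRGame ι V) (i : ι) (ρ : ℕ → V) : ℕ∞ :=
  ⨅ l ∈ {l : ℕ | ρ l ∈ G.F i}, (l : ℕ∞)

/-- Cost of player `i` for the finite prefix `ρ₀ … ρ_{m-1}` of a play. -/
noncomputable def costLT (G : QRGame ι V) (i : ι) (ρ : ℕ → V) (m : ℕ) : ℕ∞ :=
  ⨅ l ∈ {l : ℕ | l < m ∧ ρ l ∈ G.F i}, (l : ℕ∞)

end QRGame

/-- The preference relation `≺_j` of player `j` on cost profiles: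
`x ≺_j y` iff `x j > y j`, or `x j = y j`, every player's cost does not
decrease, and some player's cost strictly increases. -/
def Prec {ι : Type} (j : ι) (x y : ι → ℕ∞) : Prop :=
  y j < x j ∨ (x j = y j ∧ (∀ i, x i ≤ y i) ∧ ∃ i, x i < y i)

namespace QRGame

variable {ι V : Type} [DecidableEq ι]

/-- `σ` restricted after the history `h` is a secure equilibrium in the subgame
`(G|_h, cur h)`: no player `j` has a `≺_j`-profitable deviation after `h`
(costs are computed on the whole play, including the prefix `h`). -/
def IsSecureAfter (G : QRGame ι V) (v₀ : V) (σ : ι → List V → V) (h : List V) : Prop :=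
  ¬ ∃ (j : ι) (σ' : List V → V), G.IsStrat v₀ j σ' ∧
      Prec j (fun i => G.cost i (G.fullPlay v₀ σ h))
        (fun i => G.cost i (G.fullPlay v₀ (Function.update σ j σ') h))

/-- A secure equilibrium in `(G, v₀)`. -/
def IsSecure (G : QRGame ι V) (v₀ : V) (σ : ι → List V → V) : Prop :=
  G.IsSecureAfter v₀ σ [v₀]

/-- A subgame perfect secure equilibrium: a secure equilibrium in every subgame. -/
def IsSPSE (G : QRGame ι V) (v₀ : V) (σ : ι → List V → V) : Prop :=
  ∀ h : List V, G.IsHist v₀ h → G.IsSecureAfter v₀ σ h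

end QRGame

namespace QRGame

variable {ι V : Type} [Fintype V]

/-- A strategy profile with outcome `ρ` is goal-optimal (with bound `Γ`) if
every goal set visited by `ρ` is visited before depth `Γ`. -/
noncomputable def GoalOpt (G : QRGame ι V) (v₀ : V) (σ : ι → List V → V) (Γ : ℕ) : Prop :=
  ∀ i, G.cost i (G.outcome v₀ σ) ≠ ⊤ → G.cost i (G.outcome v₀ σ) < (Γ : ℕ∞)

/-- The bound `D = max{Cost_i(ρ) : Cost_i(ρ) < +∞} + |V|` attached to a play `ρ`. -/
noncomputable def devBound (G : QRGame ι V) (ρ : ℕ → V) : ℕ :=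
  (⨆ i ∈ {i : ι | G.cost i ρ ≠ ⊤}, G.cost i ρ).toNat + Fintype.card V

variable [DecidableEq ι]

/-- A secure equilibrium with outcome `ρ` is dev-optimal if for every player
`j` and deviation `σ'_j` (with resulting play `ρ'`), the cost profile of the
prefix `ρ_{<D}` is not `≺_j` the cost profile of the prefix `ρ'_{<D}`, where
`D = max{Cost_i(ρ) : Cost_i(ρ) < +∞} + |V|`. -/
noncomputable def DevOpt (G : QRGame ι V) (v₀ : V) (σ : ι → List V → V) : Prop :=
  ∀ (j : ι) (σ' : List V → V), G.IsStrat v₀ j σ' →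
    ¬ Prec j
        (fun i => G.costLT i (G.outcome v₀ σ) (G.devBound (G.outcome v₀ σ)))
        (fun i => G.costLT i (G.outcome v₀ (Function.update σ j σ'))
          (G.devBound (G.outcome v₀ σ)))

end QRGame

namespace QRGame

/-- The history formed by the first `n + 1` vertices of the play `π`. -/
def hist {V : Type} (π : ℕ → V) (n : ℕ) : List V := ((List.range (n + 1)).map π).reverse

/-- The play that starts with the history `h` and then stays at `v₀`. -/
def toPlay {V : Type} (v₀ : V) (h : List V) (n : ℕ) : V := h.reverse.getD n v₀

section Histories

variable {ι V : Type}

theorem hist_zero (π : ℕ → V) : hist π 0 = [π 0] := by simp [hist]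

theorem hist_succ (π : ℕ → V) (n : ℕ) : hist π (n + 1) = π (n + 1) :: hist π n := by
  simp [hist, List.range_succ]

@[simp] theorem length_hist (π : ℕ → V) (n : ℕ) : (hist π n).length = n + 1 := by simp [hist]

@[simp] theorem cur_hist (v₀ : V) (π : ℕ → V) (n : ℕ) : cur v₀ (hist π n) = π n := by
  cases n <;> simp [hist_zero, hist_succ, cur]

theorem hist_congr {π π' : ℕ → V} {n : ℕ} (h : ∀ k ≤ n, π k = π' k) : hist π n = hist π' n := by
  unfold hist
  congr 1
  apply List.map_congr_left
  intro k hk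
  exact h k (by simpa [Nat.lt_succ_iff] using hk)

theorem toPlay_hist (v₀ : V) (π : ℕ → V) {n k : ℕ} (h : k ≤ n) :
    toPlay v₀ (hist π n) k = π k := by
  simp [toPlay, hist, List.getD, Nat.lt_succ_of_le h]

theorem toPlay_length_sub_one (v₀ : V) (h : List V) :
    toPlay v₀ h (h.length - 1) = cur v₀ h := by
  cases h <;> simp [toPlay, cur, List.getD]

theorem eq_of_recursion {v₀ : V} {t : List V → V} {π π' : ℕ → V} (h0 : π 0 = v₀)
    (h : ∀ n, π (n + 1) = t (hist π n)) (h0' : π' 0 = v₀)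
    (h' : ∀ n, π' (n + 1) = t (hist π' n)) : π = π' := by
  have key : ∀ n, ∀ k ≤ n, π k = π' k := by
    intro n
    induction n with
    | zero =>
      intro k hk
      obtain rfl : k = 0 := by omega
      rw [h0, h0']
    | succ n ih =>
      intro k hk
      rcases Nat.lt_or_ge k (n + 1) with hk' | hk'
      · exact ih k (by omega)
      · obtain rfl : k = n + 1 := by omega
        rw [h, h', hist_congr ih]
  exact funext fun n => key n n le_rfl

theorem outcome_zero (G : QRGame ι V) (v₀ : V) (σ : ι → List V → V) :
    G.outcome v₀ σ 0 = v₀ := by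
  simp [outcome, fullPlay, histFrom]

theorem histFrom_eq_hist (G : QRGame ι V) (v₀ : V) (σ : ι → List V → V) (n : ℕ) :
    G.histFrom v₀ σ [v₀] n = hist (G.outcome v₀ σ) n := by
  induction n with
  | zero => simp [histFrom, hist_zero, outcome_zero]
  | succ n ih =>
    have h : G.outcome v₀ σ (n + 1) =
        σ (G.owner (cur v₀ (G.histFrom v₀ σ [v₀] n))) (G.histFrom v₀ σ [v₀] n) := by
      have hl : (G.histFrom v₀ σ [v₀] n).length = n + 1 := by rw [ih, length_hist]
      simp [outcome, fullPlay, histFrom, List.getD, hl]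
    rw [hist_succ, h, ← ih, histFrom]

theorem outcome_succ (G : QRGame ι V) (v₀ : V) (σ : ι → List V → V) (n : ℕ) :
    G.outcome v₀ σ (n + 1) =
      σ (G.owner (G.outcome v₀ σ n)) (hist (G.outcome v₀ σ) n) := by
  have h := histFrom_eq_hist G v₀ σ (n + 1)
  rw [hist_succ, histFrom, histFrom_eq_hist, cur_hist] at h
  exact (List.cons.inj h).1.symm

theorem exists_play_of_move (v₀ : V) (t : List V → V) :
    ∃ π : ℕ → V, π 0 = v₀ ∧ ∀ n, π (n + 1) = t (hist π n) := by
  let G : QRGame Unit V := ⟨fun _ => (), fun _ _ => True, fun v => ⟨v, trivial⟩,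
    fun _ => Set.univ, fun _ => ⟨v₀, trivial⟩⟩
  exact ⟨G.outcome v₀ fun _ => t, outcome_zero .., outcome_succ G v₀ fun _ => t⟩

theorem isHist_hist (G : QRGame ι V) {v₀ : V} {π : ℕ → V} (h0 : π 0 = v₀) {n : ℕ}
    (hE : ∀ k < n, G.E (π k) (π (k + 1))) : G.IsHist v₀ (hist π n) := by
  induction n with
  | zero => simpa [hist_zero, IsHist] using h0
  | succ n ih =>
    have ih' := ih fun k hk => hE k (by omega)
    have hn := hE n (by omega)
    cases n with
    | zero =>
      rw [hist_succ, hist_zero]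
      rw [hist_zero] at ih'
      exact ⟨hn, ih'⟩
    | succ n =>
      rw [hist_succ, hist_succ]
      rw [hist_succ] at ih'
      exact ⟨hn, ih'⟩

end Histories

section Costs

variable {ι V : Type}

theorem le_cost_iff (G : QRGame ι V) {i : ι} {π : ℕ → V} {c : ℕ∞} :
    c ≤ G.cost i π ↔ ∀ n, π n ∈ G.F i → c ≤ n := by
  simp [cost]

theorem cost_le (G : QRGame ι V) {i : ι} {π : ℕ → V} {n : ℕ} (h : π n ∈ G.F i) :
    G.cost i π ≤ n :=
  G.le_cost_iff.1 le_rfl n h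

theorem le_costLT_iff (G : QRGame ι V) {i : ι} {π : ℕ → V} {D : ℕ} {c : ℕ∞} :
    c ≤ G.costLT i π D ↔ ∀ n < D, π n ∈ G.F i → c ≤ n := by
  simp [costLT]

theorem costLT_le (G : QRGame ι V) {i : ι} {π : ℕ → V} {D n : ℕ} (hn : n < D)
    (h : π n ∈ G.F i) : G.costLT i π D ≤ n :=
  G.le_costLT_iff.1 le_rfl n hn h

theorem cost_le_costLT (G : QRGame ι V) (i : ι) (π : ℕ → V) (D : ℕ) :
    G.cost i π ≤ G.costLT i π D :=
  G.le_costLT_iff.2 fun _ _ h => G.cost_le h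

theorem exists_lt_of_cost_lt (G : QRGame ι V) {i : ι} {π : ℕ → V} {c : ℕ∞}
    (h : G.cost i π < c) : ∃ n : ℕ, π n ∈ G.F i ∧ (n : ℕ∞) < c := by
  by_contra! hc
  exact absurd (G.le_cost_iff.2 hc) (not_le.2 h)

theorem mem_of_cost_eq (G : QRGame ι V) {i : ι} {π : ℕ → V} {n : ℕ}
    (h : G.cost i π = n) : π n ∈ G.F i := by
  obtain ⟨m, hm, hlt⟩ := G.exists_lt_of_cost_lt (i := i) (π := π) (c := (n + 1 : ℕ))
    (by rw [h]; exact_mod_cast Nat.lt_succ_self n)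
  have h1 := G.cost_le hm
  rw [h] at h1
  have h2 : n ≤ m := by exact_mod_cast h1
  have h3 : m < n + 1 := by exact_mod_cast hlt
  obtain rfl : m = n := by omega
  exact hm

theorem mem_of_costLT_eq (G : QRGame ι V) {i : ι} {π : ℕ → V} {D n : ℕ}
    (h : G.costLT i π D = n) : π n ∈ G.F i := by
  by_contra hn
  have h1 : ((n + 1 : ℕ) : ℕ∞) ≤ G.costLT i π D := by
    refine G.le_costLT_iff.2 fun m hm hmF => ?_
    have h2 := G.costLT_le hm hmF
    rw [h] at h2
    have h3 : n ≤ m := by exact_mod_cast h2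
    have h4 : m ≠ n := by rintro rfl; exact hn hmF
    exact_mod_cast (show n + 1 ≤ m by omega)
  rw [h] at h1
  have : n + 1 ≤ n := by exact_mod_cast h1
  omega

theorem costLT_eq_cost (G : QRGame ι V) {i : ι} {π : ℕ → V} {D : ℕ}
    (h : G.cost i π ≠ ⊤ → G.cost i π < D) : G.costLT i π D = G.cost i π := by
  refine le_antisymm ?_ (G.cost_le_costLT i π D)
  by_cases htop : G.cost i π = ⊤
  · simp [htop]
  · obtain ⟨m, hm⟩ := ENat.ne_top_iff_exists.1 htop
    have hlt := h htop
    rw [← hm] at hlt ⊢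
    exact G.costLT_le (by exact_mod_cast hlt) (G.mem_of_cost_eq hm.symm)

/-- If `α` arises from `β` by removing the `d` vertices following index `p`, then goals reached
up to `p` keep their cost. -/
theorem cost_eq_of_remove_of_le (G : QRGame ι V) {i : ι} {α β : ℕ → V} {p : ℕ}
    (h₁ : ∀ n ≤ p, α n = β n) (hi : G.cost i β ≤ p) : G.cost i α = G.cost i β := by
  have hfin : G.cost i β ≠ ⊤ := ne_top_of_le_ne_top (ENat.natCast_ne_top p) hi
  obtain ⟨m, hm⟩ := ENat.ne_top_iff_exists.1 hfin
  have hmp : m ≤ p := by rw [← hm] at hi; exact_mod_cast hi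
  apply le_antisymm
  · rw [← hm]
    exact G.cost_le (by rw [h₁ m hmp]; exact G.mem_of_cost_eq hm.symm)
  · refine G.le_cost_iff.2 fun n hn => ?_
    rcases le_or_gt n p with h | h
    · exact G.cost_le (by rwa [← h₁ n h])
    · exact hi.trans (by exact_mod_cast h.le)

/-- If `α` arises from `β` by removing the `d` vertices following index `p`, then goals not
reached up to `p + d` are reached exactly `d` steps earlier. -/
theorem cost_eq_add_of_remove (G : QRGame ι V) {i : ι} {α β : ℕ → V} {p d : ℕ}
    (h₁ : ∀ n ≤ p, α n = β n) (h₂ : ∀ n > p, α n = β (n + d))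
    (hi : ∀ n ≤ p + d, β n ∉ G.F i) : G.cost i β = G.cost i α + d := by
  apply le_antisymm
  · by_cases htop : G.cost i α = ⊤
    · simp [htop]
    obtain ⟨m, hm⟩ := ENat.ne_top_iff_exists.1 htop
    have hmF := G.mem_of_cost_eq hm.symm
    have hmp : p < m := by
      by_contra! hle
      exact hi m (by omega) (h₁ m hle ▸ hmF)
    rw [← hm]
    rw [h₂ m hmp] at hmF
    exact_mod_cast G.cost_le hmF
  · refine G.le_cost_iff.2 fun n hn => ?_
    have hnp : p + d < n := by
      by_contra! hle
      exact hi n hle hn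
    have : α (n - d) ∈ G.F i := by
      rw [h₂ (n - d) (by omega), Nat.sub_add_cancel (by omega)]
      exact hn
    calc G.cost i α + d ≤ ((n - d : ℕ) : ℕ∞) + d := by gcongr; exact G.cost_le this
      _ = n := by exact_mod_cast Nat.sub_add_cancel (by omega)

end Costs

/-- `π` is a play from `v₀` in which every player except possibly `j` moves according to `s`. -/
structure Consistent {ι V : Type} (G : QRGame ι V) (v₀ : V) (j : ι) (s : List V → V)
    (π : ℕ → V) : Prop where
  start : π 0 = v₀
  edge : ∀ n, G.E (π n) (π (n + 1))
  move : ∀ n, G.owner (π n) ≠ j → π (n + 1) = s (hist π n)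

/-- For every player `j` there is a strategy of the coalition against `j` which follows `ρ` and
guarantees the property `Q j`. -/
def Sustains {ι V : Type} (G : QRGame ι V) (v₀ : V) (ρ : ℕ → V)
    (Q : ι → (ℕ → V) → Prop) : Prop :=
  ∀ j, ∃ s : List V → V, (∀ h, G.E (cur v₀ h) (s h)) ∧ (∀ n, s (hist ρ n) = ρ (n + 1)) ∧
    ∀ π, G.Consistent v₀ j s π → Q j π

/-- Player `j` does not prefer the cost profile of `π` to that of `ρ`. -/
def NoGain {ι V : Type} (G : QRGame ι V) (ρ : ℕ → V) (j : ι) (π : ℕ → V) : Prop :=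
  ¬ Prec j (fun i => G.cost i ρ) (fun i => G.cost i π)

section Profiles

variable {ι V : Type}

theorem outcome_edge (G : QRGame ι V) {v₀ : V} {σ : ι → List V → V} (hσ : G.IsProfile v₀ σ)
    (n : ℕ) : G.E (G.outcome v₀ σ n) (G.outcome v₀ σ (n + 1)) := by
  induction n using Nat.strong_induction_on with
  | _ n ih =>
    have h := hσ (G.owner (G.outcome v₀ σ n)) (hist (G.outcome v₀ σ) n)
      (G.isHist_hist (outcome_zero ..) ih) (by rw [cur_hist])
    rwa [cur_hist, ← outcome_succ G v₀ σ n] at h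

theorem isProfile_update [DecidableEq ι] (G : QRGame ι V) {v₀ : V} {σ : ι → List V → V}
    (hσ : G.IsProfile v₀ σ) {j : ι} {σ' : List V → V} (hσ' : G.IsStrat v₀ j σ') :
    G.IsProfile v₀ (Function.update σ j σ') := by
  intro i
  by_cases h : i = j
  · subst h
    simpa using hσ'
  · simpa [h] using hσ i

theorem IsSecure.sustains [DecidableEq ι] (G : QRGame ι V) {v₀ : V} {σ : ι → List V → V}
    (hσ : G.IsProfile v₀ σ) (hsec : G.IsSecure v₀ σ) :
    G.Sustains v₀ (G.outcome v₀ σ) (G.NoGain (G.outcome v₀ σ)) := by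
  intro j
  choose succ hsucc using G.total
  have hmove : ∀ π : ℕ → V, π 0 = v₀ → (∀ n, G.E (π n) (π (n + 1))) → ∀ n,
      G.E (π n) (σ (G.owner (π n)) (hist π n)) := by
    intro π h0 hE n
    have h := hσ (G.owner (π n)) (hist π n) (G.isHist_hist h0 fun k _ => hE k) (by simp)
    simpa using h
  refine ⟨fun h => if G.E (cur v₀ h) (σ (G.owner (cur v₀ h)) h)
    then σ (G.owner (cur v₀ h)) h else succ (cur v₀ h), ?_, ?_, ?_⟩
  · intro h
    dsimp only
    split_ifs with hc
    exacts [hc, hsucc _]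
  · intro n
    have h := hmove _ (outcome_zero G v₀ σ) (G.outcome_edge hσ) n
    simp only [cur_hist]
    rw [if_pos h, outcome_succ]
  · intro π hπ hprec
    refine hsec ⟨j, fun h => if hist π (h.length - 1) = h then π h.length else σ j h, ?_, ?_⟩
    · intro h hh hj
      dsimp only
      split_ifs with hc
      · have hlen : h.length - 1 + 1 = h.length := by
          cases h with
          | nil => exact hh.elim
          | cons a t => simp
        have he := hπ.edge (h.length - 1)
        rwa [hlen, ← cur_hist v₀ π (h.length - 1), hc] at he
      · exact hσ j h hh hj
    · have : G.outcome v₀ (Function.update σ j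
          fun h => if hist π (h.length - 1) = h then π h.length else σ j h) = π := by
        refine eq_of_recursion (t := fun h => Function.update σ j
          (fun h => if hist π (h.length - 1) = h then π h.length else σ j h)
          (G.owner (cur v₀ h)) h) (outcome_zero ..) (fun n => ?_) hπ.start fun n => ?_
        · rw [outcome_succ, cur_hist]
        · rw [cur_hist]
          by_cases hj : G.owner (π n) = j
          · simp [hj]
          · rw [hπ.move n hj]
            simp [hj, hmove π hπ.start hπ.edge n]
      change Prec j (fun i => G.cost i (G.outcome v₀ σ))
        (fun i => G.cost i (G.outcome v₀ (Function.update σ j _)))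
      rw [this]
      exact hprec

/-- The owner of the vertex at which the history leaves `ρ`. -/
noncomputable def deviator (G : QRGame ι V) (v₀ : V) (ρ : ℕ → V) : List V → ι
  | [] => G.owner v₀
  | _ :: t => if t = hist ρ (t.length - 1) then G.owner (cur v₀ t) else deviator G v₀ ρ t

theorem Sustains.exists_profile [DecidableEq ι] (G : QRGame ι V) {v₀ : V} {ρ : ℕ → V}
    {Q : ι → (ℕ → V) → Prop} (h : G.Sustains v₀ ρ Q) (h0 : ρ 0 = v₀) :
    ∃ τ : ι → List V → V, G.IsProfile v₀ τ ∧ G.outcome v₀ τ = ρ ∧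
      ∀ j σ', G.IsStrat v₀ j σ' → Q j (G.outcome v₀ (Function.update τ j σ')) := by
  choose s hval hρ hQ using h
  have hτ : G.IsProfile v₀ fun _ h => s (G.deviator v₀ ρ h) h := fun i h _ _ => hval _ h
  refine ⟨fun _ h => s (G.deviator v₀ ρ h) h, hτ, ?_, ?_⟩
  · refine eq_of_recursion (t := fun h => s (G.deviator v₀ ρ h) h) (outcome_zero ..)
      (fun n => outcome_succ ..) h0 fun n => (hρ _ n).symm
  · intro j σ' hσ'
    set π := G.outcome v₀ (Function.update (fun _ h => s (G.deviator v₀ ρ h) h) j σ') with hπ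
    have hstep : ∀ n, G.owner (π n) ≠ j →
        π (n + 1) = s (G.deviator v₀ ρ (hist π n)) (hist π n) := by
      intro n hn
      rw [hπ, outcome_succ, ← hπ, Function.update_of_ne hn]
    have hdev : ∀ n, hist π n ≠ hist ρ n → G.deviator v₀ ρ (hist π n) = j := by
      intro n
      induction n with
      | zero =>
        intro hne
        refine absurd ?_ hne
        rw [hist_zero, hist_zero, h0, hπ, outcome_zero]
      | succ n ih =>
        intro hne
        rw [hist_succ, deviator, length_hist, Nat.add_sub_cancel]
        split_ifs with heq
        · rw [cur_hist]
          by_contra hj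
          apply hne
          rw [hist_succ, hist_succ, hstep n hj, heq, hρ]
        · exact ih heq
    refine hQ j π ⟨outcome_zero .., G.outcome_edge (G.isProfile_update hτ hσ'), ?_⟩
    intro n hn
    rw [hstep n hn]
    by_cases heq : hist π n = hist ρ n
    · rw [heq, hρ, hρ]
    · rw [hdev n heq]

end Profiles

section Attractor

variable {ι V : Type}

/-- The vertices of `X` from which the coalition against `j` can force, inside `X`, a visit to
`T` within `n` steps. -/
def attr (G : QRGame ι V) (j : ι) (X T : Set V) : ℕ → Set V
  | 0 => T ∩ X
  | n + 1 => attr G j X T n ∪ {v | v ∈ X ∧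
      (G.owner v = j → ∀ w, G.E v w → w ∈ attr G j X T n) ∧
      (G.owner v ≠ j → ∃ w, G.E v w ∧ w ∈ attr G j X T n)}

theorem attr_mono (G : QRGame ι V) (j : ι) (X T : Set V) : Monotone (G.attr j X T) :=
  monotone_nat_of_le_succ fun _ => Set.subset_union_left

theorem attr_subset (G : QRGame ι V) (j : ι) (X T : Set V) (n : ℕ) : G.attr j X T n ⊆ X := by
  induction n with
  | zero => exact Set.inter_subset_right
  | succ n ih => exact Set.union_subset ih fun v hv => hv.1

theorem exists_attr_eq_succ [Fintype V] (G : QRGame ι V) (j : ι) (X T : Set V)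
    (hne : (T ∩ X).Nonempty) :
    ∃ m < Fintype.card V, G.attr j X T m = G.attr j X T (m + 1) := by
  by_contra! hc
  have key : ∀ n ≤ Fintype.card V, n + 1 ≤ (G.attr j X T n).ncard := by
    intro n
    induction n with
    | zero => exact fun _ => (Set.ncard_pos (Set.toFinite _)).2 hne
    | succ n ih =>
      intro hn
      have hlt : (G.attr j X T n).ncard < (G.attr j X T (n + 1)).ncard := Set.ncard_lt_ncard
        (lt_of_le_of_ne (G.attr_mono j X T n.le_succ) (hc n (by omega))) (Set.toFinite _)
      have := ih (by omega)
      omega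
  have h1 := key _ le_rfl
  have h2 := Set.ncard_le_card (G.attr j X T (Fintype.card V))
  rw [Nat.card_eq_fintype_card] at h2
  omega

theorem exists_consistent_extension (G : QRGame ι V) {v₀ : V} {j : ι} {s : List V → V}
    (hs : ∀ h, G.E (cur v₀ h) (s h)) {g : V → V} (hg : ∀ v, G.E v (g v)) {π : ℕ → V}
    (h0 : π 0 = v₀) (hE : ∀ n, G.E (π n) (π (n + 1))) {p : ℕ}
    (hm : ∀ n < p, G.owner (π n) ≠ j → π (n + 1) = s (hist π n)) :
    ∃ θ, G.Consistent v₀ j s θ ∧ (∀ n ≤ p, θ n = π n) ∧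
      ∀ n ≥ p, G.owner (θ n) = j → θ (n + 1) = g (θ n) := by
  obtain ⟨θ, hθ0, hθ⟩ := exists_play_of_move v₀ fun h =>
    if h.length ≤ p then π h.length
    else if G.owner (cur v₀ h) = j then g (cur v₀ h) else s h
  simp only [length_hist, cur_hist] at hθ
  have hagree : ∀ n ≤ p, θ n = π n := by
    intro n hn
    cases n with
    | zero => rw [hθ0, h0]
    | succ n => rw [hθ, if_pos hn]
  refine ⟨θ, ⟨hθ0, fun n => ?_, fun n hn => ?_⟩, hagree, fun n hn hj => ?_⟩
  · rw [hθ]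
    split_ifs with h1 h2
    · rw [hagree n (by omega)]
      exact hE n
    · exact hg _
    · simpa using hs (hist θ n)
  · rw [hθ]
    split_ifs with h1
    · rw [hagree n (by omega)] at hn
      rw [hm n (by omega) hn, hist_congr fun k hk => hagree k (by omega)]
    · rfl
  · rw [hθ, if_neg (by omega), if_pos hj]

/-- If the coalition against `j` can, after histories of length `p + 1` satisfying `K`, avoid `B`
forever and reach `T`, then it can do so reaching `T` in fewer than `|V|` steps. -/
theorem exists_fast_strategy [Fintype V] (G : QRGame ι V) {v₀ : V} {j : ι} {s : List V → V}
    (hs : ∀ h, G.E (cur v₀ h) (s h)) {p : ℕ} {K : (ℕ → V) → Prop}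
    (hK : ∀ π π' : ℕ → V, (∀ n ≤ p, π n = π' n) → K π → K π') {B T : Set V}
    (hBT : ∀ π, G.Consistent v₀ j s π → K π → (∀ n ≥ p, π n ∉ B) ∧ ∃ n ≥ p, π n ∈ T) :
    ∃ s' : List V → V, (∀ h, G.E (cur v₀ h) (s' h)) ∧
      (∀ π n, (p ≤ n → ¬ K π) → s' (hist π n) = s (hist π n)) ∧
      ∀ π, G.Consistent v₀ j s' π → K π →
        (∀ n ≥ p, π n ∉ B) ∧ ∃ n ≥ p, n < p + Fintype.card V ∧ π n ∈ T := by
  choose succ hsucc using G.total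
  let X : Set V := {v | ∃ π, G.Consistent v₀ j s π ∧ K π ∧ ∃ n ≥ p, π n = v}
  have hXj : ∀ v ∈ X, G.owner v = j → ∀ w, G.E v w → w ∈ X := by
    rintro _ ⟨π, hπ, hKπ, n, hn, rfl⟩ hj w hw
    obtain ⟨θ, hθ, hagree, hg⟩ := G.exists_consistent_extension hs
      (g := fun v => if G.E v w then w else succ v)
      (fun v => by split_ifs with h; exacts [h, hsucc v]) hπ.start hπ.edge
      (p := n) fun k _ => hπ.move k
    refine ⟨θ, hθ, hK π θ (fun k hk => (hagree k (by omega)).symm) hKπ, n + 1, by omega, ?_⟩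
    rw [hg n le_rfl (by rwa [hagree n le_rfl]), hagree n le_rfl, if_pos hw]
  have hXs : ∀ v ∈ X, G.owner v ≠ j → ∃ w, G.E v w ∧ w ∈ X := by
    rintro _ ⟨π, hπ, hKπ, n, hn, rfl⟩ _
    exact ⟨π (n + 1), hπ.edge n, π, hπ, hKπ, n + 1, by omega, rfl⟩
  have hXB : ∀ v ∈ X, v ∉ B := by
    rintro _ ⟨π, hπ, hKπ, n, hn, rfl⟩
    exact (hBT π hπ hKπ).1 n hn
  have hattr : ∀ π, G.Consistent v₀ j s π → K π →
      π p ∈ G.attr j X T (Fintype.card V - 1) := by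
    intro π hπ hKπ
    have hne : (T ∩ X).Nonempty := by
      obtain ⟨n, hn, hT⟩ := (hBT π hπ hKπ).2
      exact ⟨π n, hT, π, hπ, hKπ, n, hn, rfl⟩
    obtain ⟨m, hm, hstab⟩ := G.exists_attr_eq_succ j X T hne
    refine G.attr_mono j X T (show m ≤ Fintype.card V - 1 by omega) ?_
    by_contra hout
    have hgex : ∀ v, ∃ w, G.E v w ∧
        ((∃ w, G.E v w ∧ w ∉ G.attr j X T m) → w ∉ G.attr j X T m) := by
      intro v
      by_cases h : ∃ w, G.E v w ∧ w ∉ G.attr j X T m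
      · obtain ⟨w, hw, hw'⟩ := h
        exact ⟨w, hw, fun _ => hw'⟩
      · exact ⟨succ v, hsucc v, fun h' => absurd h' h⟩
    choose g hg hgout using hgex
    obtain ⟨θ, hθ, hagree, hgθ⟩ := G.exists_consistent_extension hs hg hπ.start hπ.edge
      (p := p) fun k _ => hπ.move k
    have hKθ : K θ := hK π θ (fun k hk => (hagree k hk).symm) hKπ
    have hθX : ∀ n ≥ p, θ n ∈ X := fun n hn => ⟨θ, hθ, hKθ, n, hn, rfl⟩
    have hθout : ∀ n ≥ p, θ n ∉ G.attr j X T m := by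
      intro n hn
      induction n, hn using Nat.le_induction with
      | base => rwa [hagree p le_rfl]
      | succ n hn ih =>
        intro hin
        apply ih
        rw [hstab]
        refine Or.inr ⟨hθX n hn, fun hj => ?_, fun _ => ⟨θ (n + 1), hθ.edge n, hin⟩⟩
        by_contra! hex
        rw [hgθ n hn hj] at hin
        exact hgout _ hex hin
    obtain ⟨n, hn, hT⟩ := (hBT θ hθ hKθ).2
    exact hθout n hn (G.attr_mono j X T (Nat.zero_le m) ⟨hT, hθX n hn⟩)
  have hfex : ∀ v, ∃ w, G.E v w ∧ (v ∈ X → G.owner v ≠ j → w ∈ X ∧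
      ∀ n, v ∈ G.attr j X T (n + 1) → v ∉ T → w ∈ G.attr j X T n) := by
    intro v
    by_cases hv : v ∈ X ∧ G.owner v ≠ j
    · by_cases hA : v ∉ T ∧ ∃ n, v ∈ G.attr j X T n
      · have hspec := Nat.find_spec hA.2
        have hmin := fun n => Nat.find_min' hA.2 (m := n)
        rcases hN : Nat.find hA.2 with _ | k
        · rw [hN] at hspec
          exact absurd hspec.1 hA.1
        · rw [hN] at hspec hmin
          rcases hspec with h | ⟨-, -, h⟩
          · have := hmin k h
            omega
          · obtain ⟨w, hw, hwA⟩ := h hv.2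
            refine ⟨w, hw, fun _ _ => ⟨G.attr_subset j X T k hwA, fun n hn _ => ?_⟩⟩
            have := hmin _ hn
            exact G.attr_mono j X T (show k ≤ n by omega) hwA
      · obtain ⟨w, hw, hwX⟩ := hXs v hv.1 hv.2
        exact ⟨w, hw, fun _ _ => ⟨hwX, fun n hn hT => absurd ⟨hT, n + 1, hn⟩ hA⟩⟩
    · exact ⟨succ v, hsucc v, fun h1 h2 => absurd ⟨h1, h2⟩ hv⟩
  choose f hf hfX using hfex
  have hold : ∀ π n, (p ≤ n → ¬ K π) → ¬ (p < (hist π n).length ∧ K (toPlay v₀ (hist π n))) := by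
    rintro π n h ⟨h1, h2⟩
    rw [length_hist] at h1
    have hpn : p ≤ n := by omega
    exact h hpn (hK _ _ (fun k hk => toPlay_hist v₀ π (hk.trans hpn)) h2)
  refine ⟨fun h => if p < h.length ∧ K (toPlay v₀ h) then f (cur v₀ h) else s h,
    fun h => ?_, fun π n h => if_neg (hold π n h), fun π hπ hKπ => ?_⟩
  · dsimp only
    split_ifs
    exacts [hf _, hs h]
  have hmove : ∀ n ≥ p, G.owner (π n) ≠ j → π (n + 1) = f (π n) := by
    intro n hn hj
    rw [hπ.move n hj, if_pos, cur_hist]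
    refine ⟨by rw [length_hist]; omega, ?_⟩
    exact hK π _ (fun k hk => (toPlay_hist v₀ π (hk.trans hn)).symm) hKπ
  obtain ⟨θ, hθ, hagree, -⟩ := G.exists_consistent_extension hs hsucc hπ.start hπ.edge
    (p := p) (j := j) fun k hk hj => by
      rw [hπ.move k hj, if_neg (hold π k fun h => absurd h (by omega))]
  have hKθ : K θ := hK π θ (fun k hk => (hagree k hk).symm) hKπ
  have hpX : π p ∈ X := ⟨θ, hθ, hKθ, p, le_rfl, hagree p le_rfl⟩
  have hpA := hattr θ hθ hKθ
  rw [hagree p le_rfl] at hpA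
  have hX : ∀ n ≥ p, π n ∈ X := by
    intro n hn
    induction n, hn using Nat.le_induction with
    | base => exact hpX
    | succ n hn ih =>
      by_cases hj : G.owner (π n) = j
      · exact hXj _ ih hj _ (hπ.edge n)
      · rw [hmove n hn hj]
        exact (hfX _ ih hj).1
  refine ⟨fun n hn => hXB _ (hX n hn), ?_⟩
  have hcard : 0 < Fintype.card V := Fintype.card_pos_iff.2 ⟨v₀⟩
  by_contra! hc
  have hdesc : ∀ k ≤ Fintype.card V - 1,
      π (p + k) ∈ G.attr j X T (Fintype.card V - 1 - k) := by
    intro k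
    induction k with
    | zero => exact fun _ => hpA
    | succ k ih =>
      intro hk
      have hk' := ih (by omega)
      have hT : π (p + k) ∉ T := hc (p + k) (by omega) (by omega)
      have hsub : Fintype.card V - 1 - k = Fintype.card V - 1 - (k + 1) + 1 := by omega
      rw [hsub] at hk'
      generalize Fintype.card V - 1 - (k + 1) = r at hk'
      by_cases hj : G.owner (π (p + k)) = j
      · have hstep : ∀ r, π (p + k) ∈ G.attr j X T (r + 1) →
            π (p + k + 1) ∈ G.attr j X T r := by
          intro r
          induction r with
          | zero =>
            rintro (h | h)
            · exact absurd h.1 hT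
            · exact h.2.1 hj _ (hπ.edge _)
          | succ r ihr =>
            rintro (h | h)
            · exact G.attr_mono j X T r.le_succ (ihr h)
            · exact h.2.1 hj _ (hπ.edge _)
        exact hstep r hk'
      · rw [← add_assoc, hmove (p + k) (by omega) hj]
        exact (hfX _ (hX _ (by omega)) hj).2 r hk' hT
  have hlast := hdesc _ le_rfl
  rw [Nat.sub_self] at hlast
  exact hc _ (by omega) (by omega) hlast.1

end Attractor

section Optimality

variable {ι V : Type}

theorem Sustains.noGain_costLT [Fintype V] (G : QRGame ι V) {v₀ : V} {ρ : ℕ → V}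
    (h : G.Sustains v₀ ρ (G.NoGain ρ)) {M : ℕ}
    (hM : ∀ i, G.cost i ρ ≠ ⊤ → G.cost i ρ ≤ M) :
    G.Sustains v₀ ρ fun j π => G.NoGain ρ j π ∧
      ¬ Prec j (fun i => G.costLT i ρ (M + Fintype.card V))
        (fun i => G.costLT i π (M + Fintype.card V)) := by
  intro j
  obtain ⟨s, hs, hsρ, hsπ⟩ := h j
  have hcard : 0 < Fintype.card V := Fintype.card_pos_iff.2 ⟨v₀⟩
  have hle : ∀ i (m : ℕ), G.cost i ρ = m → m ≤ M := by
    intro i m hm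
    have h1 := hM i (by rw [hm]; exact ENat.natCast_ne_top m)
    rw [hm] at h1
    exact_mod_cast h1
  have hρD : ∀ i, G.costLT i ρ (M + Fintype.card V) = G.cost i ρ := fun i =>
    G.costLT_eq_cost fun hi => (hM i hi).trans_lt (by exact_mod_cast (by omega))
  simp only [hρD]
  let K : (ℕ → V) → Prop := fun π =>
    (∀ i, ∀ n ≤ M, π n ∈ G.F i → G.cost i ρ ≤ n) ∧
    (∃ i, ∃ m : ℕ, G.cost i ρ = m ∧ π m ∉ G.F i) ∧
    (∀ m : ℕ, G.cost j ρ = m → π m ∈ G.F j)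
  have hK : ∀ π π' : ℕ → V, (∀ n ≤ M, π n = π' n) → K π → K π' := by
    rintro π π' hππ ⟨h1, ⟨i, m, hm, hmF⟩, h3⟩
    refine ⟨fun i n hn hF => h1 i n hn (by rwa [hππ n hn]),
      ⟨i, m, hm, by rwa [← hππ m (hle i m hm)]⟩,
      fun m hm => by rw [← hππ m (hle j m hm)]; exact h3 m hm⟩
  obtain ⟨s', hs', hss', hs'π⟩ := G.exists_fast_strategy hs hK
    (B := {v | G.cost j ρ = ⊤ ∧ v ∈ G.F j}) (T := {v | ∃ i, G.cost i ρ = ⊤ ∧ v ∈ G.F i})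
    (by
      rintro π hπ ⟨h1, ⟨i, m, hm, hmF⟩, h3⟩
      have hno := hsπ π hπ
      simp only [NoGain, Prec, not_or, not_lt] at hno
      obtain ⟨hj, hrest⟩ := hno
      refine ⟨?_, ?_⟩
      · rintro n - ⟨htop, hF⟩
        have := hj.trans (G.cost_le hF)
        rw [htop] at this
        exact ENat.natCast_ne_top n (top_le_iff.1 this)
      · by_contra! hT
        apply hrest
        have hall : ∀ i, G.cost i ρ ≤ G.cost i π := by
          intro i
          refine G.le_cost_iff.2 fun n hn => ?_
          rcases le_or_gt n M with hnM | hnM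
          · exact h1 i n hnM hn
          · by_cases htop : G.cost i ρ = ⊤
            · exact absurd ⟨i, htop, hn⟩ (hT n hnM.le)
            · exact (hM i htop).trans (by exact_mod_cast hnM.le)
        refine ⟨le_antisymm hj ?_, hall, i, lt_of_le_of_ne (hall i) ?_⟩
        · by_cases htop : G.cost j ρ = ⊤
          · simp [htop]
          · obtain ⟨m, hm⟩ := ENat.ne_top_iff_exists.1 htop
            rw [← hm]
            exact G.cost_le (h3 m hm.symm)
        · rw [hm]
          intro heq
          exact hmF (G.mem_of_cost_eq heq.symm))
  refine ⟨s', hs', fun n => ?_, fun π hπ => ?_⟩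
  · rw [hss', hsρ]
    rintro - ⟨-, ⟨i, m, hm, hmF⟩, -⟩
    exact hmF (G.mem_of_cost_eq hm)
  by_cases hKπ : K π
  · obtain ⟨hB, n, hn, hnlt, i, htop, hnF⟩ := hs'π π hπ hKπ
    have hj : G.cost j ρ ≤ G.cost j π := by
      refine G.le_cost_iff.2 fun n hn => ?_
      rcases le_or_gt n M with hnM | hnM
      · exact hKπ.1 j n hnM hn
      · by_cases htop : G.cost j ρ = ⊤
        · exact absurd ⟨htop, hn⟩ (hB n hnM.le)
        · exact (hM j htop).trans (by exact_mod_cast hnM.le)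
    refine ⟨?_, ?_⟩
    · rintro (h | ⟨-, h, -⟩)
      · exact absurd hj (not_le.2 h)
      · have h2 := (h i).trans (G.cost_le hnF)
        dsimp only at h2
        rw [htop] at h2
        exact ENat.natCast_ne_top n (top_le_iff.1 h2)
    · rintro (h | ⟨-, h, -⟩)
      · exact absurd (hj.trans (G.cost_le_costLT j π _)) (not_le.2 h)
      · have h2 := (h i).trans (G.costLT_le hnlt hnF)
        dsimp only at h2
        rw [htop] at h2
        exact ENat.natCast_ne_top n (top_le_iff.1 h2)
  · have hno : G.NoGain ρ j π := hsπ π ⟨hπ.start, hπ.edge, fun n hn => by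
      rw [hπ.move n hn, hss' π n fun _ => hKπ]⟩
    refine ⟨hno, ?_⟩
    rintro (h | ⟨hj, hall, i, hi⟩)
    · exact hno (Or.inl ((G.cost_le_costLT j π _).trans_lt h))
    · apply hKπ
      refine ⟨fun i n hn hF => (hall i).trans (G.costLT_le (by omega) hF), ?_, ?_⟩
      · obtain ⟨m, hm⟩ := ENat.ne_top_iff_exists.1 (ne_top_of_lt hi)
        refine ⟨i, m, hm.symm, fun hF => ?_⟩
        have h1 := hle i m hm.symm
        have h2 := G.costLT_le (D := M + Fintype.card V) (by omega) hF
        rw [hm] at h2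
        exact absurd h2 (not_le.2 hi)
      · intro m hm
        dsimp only at hj
        rw [hm] at hj
        exact G.mem_of_costLT_eq hj.symm

/-- Removing a cycle that is followed, with a delay of at least `|V|`, by the first visit to a
further goal preserves being the outcome of a secure equilibrium. -/
theorem Sustains.remove_cycle [Fintype V] (G : QRGame ι V) {v₀ : V} {ρ : ℕ → V}
    (h : G.Sustains v₀ ρ (G.NoGain ρ)) (h0 : ρ 0 = v₀) (hE : ∀ n, G.E (ρ n) (ρ (n + 1)))
    {p d : ℕ} (hd : 0 < d) (hpd : ρ (p + d) = ρ p)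
    (hgap : ∀ i, G.cost i ρ ≤ p ∨ ((p + d + Fintype.card V : ℕ) : ℕ∞) ≤ G.cost i ρ)
    (hex : ∃ i, p < G.cost i ρ ∧ G.cost i ρ ≠ ⊤) {ρ' : ℕ → V}
    (h₁ : ∀ n ≤ p, ρ' n = ρ n) (h₂ : ∀ n > p, ρ' n = ρ (n + d)) :
    G.Sustains v₀ ρ' (G.NoGain ρ') := by
  intro j
  obtain ⟨s, hs, hsρ, hsπ⟩ := h j
  have hcard : 0 < Fintype.card V := Fintype.card_pos_iff.2 ⟨v₀⟩
  have hcost : ∀ i, (G.cost i ρ ≤ p ∧ G.cost i ρ' = G.cost i ρ) ∨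
      (((p + d + Fintype.card V : ℕ) : ℕ∞) ≤ G.cost i ρ ∧ G.cost i ρ = G.cost i ρ' + d ∧
        ((p + Fintype.card V : ℕ) : ℕ∞) ≤ G.cost i ρ') := by
    intro i
    rcases hgap i with hi | hi
    · exact Or.inl ⟨hi, G.cost_eq_of_remove_of_le h₁ hi⟩
    · have hadd := G.cost_eq_add_of_remove h₁ h₂ fun n hn hF => by
        have h1 := hi.trans (G.cost_le hF)
        have h2 : p + d + Fintype.card V ≤ n := by exact_mod_cast h1
        omega
      refine Or.inr ⟨hi, hadd, ?_⟩
      rw [hadd, show p + d + Fintype.card V = p + Fintype.card V + d by omega,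
        Nat.cast_add _ d] at hi
      exact (ENat.add_le_add_iff_right (ENat.natCast_ne_top d)).1 hi
  have hle : ∀ i, G.cost i ρ' ≤ G.cost i ρ := by
    intro i
    rcases hcost i with ⟨-, h⟩ | ⟨-, h, -⟩
    · exact h.le
    · rw [h]
      exact le_self_add
  have hsmall : ∀ i, G.cost i ρ' ≤ p → G.cost i ρ = G.cost i ρ' ∧ G.cost i ρ ≤ p := by
    intro i hi
    rcases hcost i with ⟨h1, h⟩ | ⟨-, -, h⟩
    · exact ⟨h.symm, h1⟩
    · have : p + Fintype.card V ≤ p := by exact_mod_cast h.trans hi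
      omega
  let K : (ℕ → V) → Prop := fun π =>
    (∀ i, ∀ n ≤ p, π n ∈ G.F i → G.cost i ρ ≤ n) ∧
    (∀ m : ℕ, G.cost j ρ = m → m ≤ p ∧ π m ∈ G.F j)
  have hK : ∀ π π' : ℕ → V, (∀ n ≤ p, π n = π' n) → K π → K π' := by
    rintro π π' hππ ⟨h1, h2⟩
    refine ⟨fun i n hn hF => h1 i n hn (by rwa [hππ n hn]),
      fun m hm => ⟨(h2 m hm).1, by rw [← hππ m (h2 m hm).1]; exact (h2 m hm).2⟩⟩
  obtain ⟨s', hs', hss', hs'π⟩ := G.exists_fast_strategy hs hK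
    (B := {v | G.cost j ρ = ⊤ ∧ v ∈ G.F j}) (T := {v | ∃ i, p < G.cost i ρ ∧ v ∈ G.F i})
    (by
      rintro π hπ ⟨h1, h2⟩
      have hno := hsπ π hπ
      simp only [NoGain, Prec, not_or, not_lt] at hno
      obtain ⟨hj, hrest⟩ := hno
      refine ⟨?_, ?_⟩
      · rintro n - ⟨htop, hF⟩
        have := hj.trans (G.cost_le hF)
        rw [htop] at this
        exact ENat.natCast_ne_top n (top_le_iff.1 this)
      · by_contra! hT
        obtain ⟨i₀, hi₀, hfin⟩ := hex
        have hall : ∀ i, G.cost i ρ ≤ G.cost i π := by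
          intro i
          refine G.le_cost_iff.2 fun n hn => ?_
          rcases le_or_gt n p with hnp | hnp
          · exact h1 i n hnp hn
          · by_cases hi : G.cost i ρ ≤ p
            · exact hi.trans (by exact_mod_cast hnp.le)
            · exact absurd ⟨i, not_le.1 hi, hn⟩ (hT n hnp.le)
        apply hrest
        refine ⟨le_antisymm hj ?_, hall, i₀, lt_of_le_of_ne (hall i₀) fun heq => ?_⟩
        · by_cases htop : G.cost j ρ = ⊤
          · simp [htop]
          · obtain ⟨m, hm⟩ := ENat.ne_top_iff_exists.1 htop
            rw [← hm]
            exact G.cost_le (h2 m hm.symm).2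
        · obtain ⟨m, hm⟩ := ENat.ne_top_iff_exists.1 hfin
          rw [← hm] at heq hi₀
          have hpm : p ≤ m := by
            by_contra! hlt
            exact not_le.2 hi₀ (by exact_mod_cast hlt.le)
          refine hT m hpm ⟨i₀, ?_, G.mem_of_cost_eq heq.symm⟩
          rwa [← hm])
  let lift : (ℕ → V) → ℕ → V := fun π n => if n ≤ p + d then ρ n else π (n - d)
  have hlift : ∀ (π : ℕ → V) n, p ≤ n → π p = ρ p → lift π (n + d) = π n := by
    intro π n hn hp
    rcases hn.eq_or_lt with rfl | hn
    · simp only [lift, le_refl, if_true]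
      rw [hpd, hp]
    · simp only [lift]
      rw [if_neg (by omega), Nat.add_sub_cancel]
  let Agree : (ℕ → V) → Prop := fun π => ∀ n ≤ p, π n = ρ n
  let s'' : List V → V := fun h =>
    if p < h.length ∧ Agree (toPlay v₀ h)
      then s (hist (lift (toPlay v₀ h)) (h.length - 1 + d)) else s' h
  have hin : ∀ (π : ℕ → V) n, p ≤ n → Agree π →
      s'' (hist π n) = s (hist (lift π) (n + d)) := by
    intro π n hn hA
    have hc : p < (hist π n).length ∧ Agree (toPlay v₀ (hist π n)) := by
      refine ⟨by rw [length_hist]; omega, fun k hk => ?_⟩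
      rw [toPlay_hist v₀ π (hk.trans hn), hA k hk]
    simp only [s'']
    rw [if_pos hc, length_hist, Nat.add_sub_cancel]
    congr 1
    refine hist_congr fun k hk => ?_
    simp only [lift]
    split_ifs
    · rfl
    · exact toPlay_hist v₀ π (by omega)
  have hout : ∀ (π : ℕ → V) n, (p ≤ n → ¬ Agree π) → s'' (hist π n) = s' (hist π n) := by
    intro π n hA
    simp only [s'']
    rw [if_neg]
    rintro ⟨h1, h2⟩
    rw [length_hist] at h1
    have hpn : p ≤ n := by omega
    exact hA hpn fun k hk => by rw [← toPlay_hist v₀ π (hk.trans hpn), h2 k hk]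
  refine ⟨s'', fun h => ?_, fun n => ?_, fun π hπ => ?_⟩
  · by_cases hc : p < h.length ∧ Agree (toPlay v₀ h)
    · have h1 := hs (hist (lift (toPlay v₀ h)) (h.length - 1 + d))
      rw [cur_hist, hlift _ _ (by omega) (hc.2 p le_rfl), toPlay_length_sub_one] at h1
      simpa only [s'', if_pos hc] using h1
    · simpa only [s'', if_neg hc] using hs' h
  · rcases Nat.lt_or_ge n p with hn | hn
    · rw [hout ρ' n fun h => absurd h (by omega), hss' ρ' n fun h => absurd h (by omega),
        hist_congr fun k hk => h₁ k (by omega), hsρ, h₁ (n + 1) hn]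
    · rw [hin ρ' n hn h₁, h₂ (n + 1) (by omega),
        show n + 1 + d = n + d + 1 by omega, ← hsρ]
      congr 1
      refine hist_congr fun k hk => ?_
      simp only [lift]
      split_ifs with hk'
      · rfl
      · rw [h₂ (k - d) (by omega), Nat.sub_add_cancel (by omega)]
  by_cases hA : Agree π
  · have hcons : G.Consistent v₀ j s (lift π) := by
      have hlow : ∀ n ≤ p + d, lift π n = ρ n := fun n hn => if_pos hn
      have hhigh : ∀ n ≥ p + d, lift π n = π (n - d) := by
        intro n hn
        obtain ⟨k, rfl⟩ : ∃ k, n = k + d := ⟨n - d, by omega⟩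
        rw [hlift π k (by omega) (hA p le_rfl), Nat.add_sub_cancel]
      refine ⟨by rw [hlow 0 (by omega), h0], fun n => ?_, fun n hn => ?_⟩
      · rcases Nat.lt_or_ge n (p + d) with hlt | hge
        · rw [hlow n hlt.le, hlow (n + 1) hlt]
          exact hE n
        · rw [hhigh n hge, hhigh (n + 1) (by omega), show n + 1 - d = n - d + 1 by omega]
          exact hπ.edge _
      · rcases Nat.lt_or_ge n (p + d) with hlt | hge
        · rw [hlow (n + 1) hlt, hist_congr fun k hk => hlow k (by omega), hsρ]
        · rw [hhigh n hge] at hn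
          rw [hhigh (n + 1) (by omega), show n + 1 - d = n - d + 1 by omega,
            hπ.move _ hn, hin π _ (by omega) hA, Nat.sub_add_cancel (by omega)]
    have hno := hsπ _ hcons
    have hl₁ : ∀ n ≤ p, π n = lift π n := fun n hn => by
      simp only [lift]
      rw [if_pos (by omega), hA n hn]
    have hl₂ : ∀ n > p, π n = lift π (n + d) := fun n hn =>
      (hlift π n hn.le (hA p le_rfl)).symm
    have hrel : ∀ i, (G.cost i ρ = G.cost i ρ' ∧ G.cost i (lift π) = G.cost i π) ∨
        (G.cost i ρ = G.cost i ρ' + d ∧ G.cost i (lift π) = G.cost i π + d) := by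
      intro i
      rcases hcost i with ⟨hi, heq⟩ | ⟨hi, heq, -⟩
      · refine Or.inl ⟨heq.symm, (G.cost_eq_of_remove_of_le hl₁ ?_).symm⟩
        obtain ⟨m, hm⟩ := ENat.ne_top_iff_exists.1
          (ne_top_of_le_ne_top (ENat.natCast_ne_top p) hi)
        have hmF := G.mem_of_cost_eq hm.symm
        rw [← hm] at hi
        have hmp : m ≤ p := by exact_mod_cast hi
        rw [← hA m hmp, hl₁ m hmp] at hmF
        exact (G.cost_le hmF).trans hi
      · refine Or.inr ⟨heq, G.cost_eq_add_of_remove hl₁ hl₂ fun n hn hF => ?_⟩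
        simp only [lift] at hF
        rw [if_pos hn] at hF
        have h1 : p + d + Fintype.card V ≤ n := by exact_mod_cast hi.trans (G.cost_le hF)
        omega
    have hdtop := ENat.natCast_ne_top d
    have hlt_iff : ∀ i, G.cost i ρ < G.cost i (lift π) ↔ G.cost i ρ' < G.cost i π := by
      intro i
      rcases hrel i with ⟨h1, h2⟩ | ⟨h1, h2⟩
      · rw [h1, h2]
      · rw [h1, h2, ENat.add_lt_add_iff_right hdtop]
    have hle_iff : ∀ i, G.cost i ρ ≤ G.cost i (lift π) ↔ G.cost i ρ' ≤ G.cost i π := by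
      intro i
      rcases hrel i with ⟨h1, h2⟩ | ⟨h1, h2⟩
      · rw [h1, h2]
      · rw [h1, h2, ENat.add_le_add_iff_right hdtop]
    rintro (h | ⟨hj, hall, i, hi⟩)
    · exact hno (Or.inl (by
        by_contra hc
        exact absurd h (not_lt.2 ((hle_iff j).1 (not_lt.1 hc)))))
    · refine hno (Or.inr ⟨?_, fun i => (hle_iff i).2 (hall i), i, (hlt_iff i).2 hi⟩)
      exact le_antisymm ((hle_iff j).2 hj.le)
        (by
          by_contra hc
          exact absurd hj ((hlt_iff j).1 (not_le.1 hc)).ne)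
  · have hcons : G.Consistent v₀ j s' π := ⟨hπ.start, hπ.edge, fun n hn => by
      rw [hπ.move n hn, hout π n fun _ => hA]⟩
    by_cases hKπ : K π
    · obtain ⟨hB, n, hn, hnlt, i, hi, hnF⟩ := hs'π π hcons hKπ
      rintro (h | ⟨-, hall, -⟩)
      · refine absurd ?_ (not_le.2 h)
        refine (hle j).trans (G.le_cost_iff.2 fun n hn => ?_)
        rcases le_or_gt n p with hnp | hnp
        · exact hKπ.1 j n hnp hn
        · by_cases htop : G.cost j ρ = ⊤
          · exact absurd ⟨htop, hn⟩ (hB n hnp.le)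
          · obtain ⟨m, hm⟩ := ENat.ne_top_iff_exists.1 htop
            have := (hKπ.2 m hm.symm).1
            rw [← hm]
            exact_mod_cast (by omega)
      · rcases hcost i with ⟨hi', -⟩ | ⟨-, -, hi'⟩
        · exact not_le.2 hi hi'
        · have h1 := (hi'.trans (hall i)).trans (G.cost_le hnF)
          have h2 : p + Fintype.card V ≤ n := by exact_mod_cast h1
          omega
    · have hno : G.NoGain ρ j π := hsπ π ⟨hπ.start, hπ.edge, fun n hn => by
        rw [hcons.move n hn, hss' π n fun _ => hKπ]⟩
      rintro (h | ⟨hj, hall, -⟩)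
      · exact hno (Or.inl (h.trans_le (hle j)))
      · apply hKπ
        refine ⟨fun i n hn hF => ?_, fun m hm => ?_⟩
        · have h1 := (hall i).trans (G.cost_le hF)
          rw [(hsmall i (h1.trans (by exact_mod_cast hn))).1]
          exact h1
        · have hjρ : G.cost j ρ ≤ G.cost j ρ' := by
            by_contra hc
            exact hno (Or.inl (hj ▸ not_le.1 hc))
          have hjeq : G.cost j ρ' = m := (le_antisymm (hle j) hjρ).trans hm
          refine ⟨?_, G.mem_of_cost_eq (hj.symm.trans hjeq)⟩
          rcases hcost j with ⟨h1, -⟩ | ⟨-, h1, -⟩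
          · rw [hm] at h1
            exact_mod_cast h1
          · exfalso
            rw [hm, hjeq] at h1
            have : m = m + d := by exact_mod_cast h1
            omega

theorem exists_gap [Fintype ι] (x : ι → ℕ∞) (n : ℕ)
    (h : ∃ i, x i ≠ ⊤ ∧ ((2 * Fintype.card ι * n : ℕ) : ℕ∞) ≤ x i) :
    ∃ i, ∃ c : ℕ, x i = (c + 2 * n : ℕ) ∧ ∀ l, x l < x i → x l ≤ c := by
  by_contra! hc
  have key : ∀ m : ℕ, ∀ i, x i = m →
      m < 2 * (Finset.univ.filter fun l => x l ≤ m).card * n := by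
    intro m
    induction m using Nat.strong_induction_on with
    | _ m ih =>
      intro i hi
      rcases Nat.lt_or_ge m (2 * n) with hm | hm
      · have hpos : 1 ≤ (Finset.univ.filter fun l => x l ≤ m).card :=
          Finset.card_pos.2 ⟨i, by simp [hi]⟩
        nlinarith
      · obtain ⟨l, hl, hcl⟩ := hc i (m - 2 * n) (by rw [Nat.sub_add_cancel hm, hi])
        obtain ⟨k, hk⟩ := ENat.ne_top_iff_exists.1 (ne_top_of_lt hl)
        rw [← hk, hi] at hl
        rw [← hk] at hcl
        have hkm : k < m := by exact_mod_cast hl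
        have hck : m - 2 * n < k := by exact_mod_cast hcl
        have hik := ih k hkm l hk.symm
        have hcard : (Finset.univ.filter fun l => x l ≤ k).card <
            (Finset.univ.filter fun l => x l ≤ m).card := by
          refine Finset.card_lt_card (Finset.ssubset_iff_of_subset ?_ |>.2 ⟨i, ?_, ?_⟩)
          · exact Finset.monotone_filter_right _ fun a _ ha => ha.trans (by exact_mod_cast hkm.le)
          · simp [hi]
          · simp [hi, hkm]
        have hmk : m < k + 2 * n := by omega
        nlinarith [Nat.mul_le_mul_right (2 * n) (Nat.succ_le_of_lt hcard)]
  obtain ⟨i, hi, hle⟩ := h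
  obtain ⟨m, hm⟩ := ENat.ne_top_iff_exists.1 hi
  rw [← hm] at hle
  have h1 : 2 * Fintype.card ι * n ≤ m := by exact_mod_cast hle
  have h2 := key m i hm.symm
  have h3 := Finset.card_le_univ (Finset.univ.filter fun l => x l ≤ m)
  nlinarith [Nat.mul_le_mul_right n h3]

theorem exists_repetition [Fintype V] (ρ : ℕ → V) (c : ℕ) :
    ∃ p d, c ≤ p ∧ 0 < d ∧ p + d ≤ c + Fintype.card V ∧ ρ (p + d) = ρ p := by
  obtain ⟨a, b, hab, heq⟩ := Fintype.exists_ne_map_eq_of_card_lt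
    (fun k : Fin (Fintype.card V + 1) => ρ (c + k)) (by simp)
  wlog hlt : a < b generalizing a b
  · exact this b a hab.symm heq.symm (lt_of_le_of_ne (not_lt.1 hlt) hab.symm)
  have hlt' : (a : ℕ) < b := hlt
  refine ⟨c + a, b - a, by omega, by omega, by omega, ?_⟩
  rw [show c + (a : ℕ) + (b - a) = c + b by omega]
  exact heq.symm

theorem Sustains.exists_goal_bounded [Fintype ι] [Fintype V] (G : QRGame ι V) {v₀ : V}
    {ρ : ℕ → V} (h : G.Sustains v₀ ρ (G.NoGain ρ)) (h0 : ρ 0 = v₀)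
    (hE : ∀ n, G.E (ρ n) (ρ (n + 1))) :
    ∃ ρ' : ℕ → V, ρ' 0 = v₀ ∧ G.Sustains v₀ ρ' (G.NoGain ρ') ∧
      (∀ i, G.cost i ρ' ≠ ⊤ →
        G.cost i ρ' < (2 * Fintype.card ι * Fintype.card V : ℕ)) ∧
      ∀ i, G.cost i ρ' ≤ G.cost i ρ := by
  induction hN : ∑ i, (G.cost i ρ).toNat using Nat.strong_induction_on generalizing ρ with
  | _ N ih =>
    by_cases hopt : ∀ i, G.cost i ρ ≠ ⊤ →
        G.cost i ρ < (2 * Fintype.card ι * Fintype.card V : ℕ)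
    · exact ⟨ρ, h0, h, hopt, fun i => le_rfl⟩
    push Not at hopt
    obtain ⟨i₀, c, hc, hgap⟩ := exists_gap (fun i => G.cost i ρ) (Fintype.card V) hopt
    obtain ⟨p, d, hcp, hd, hpd, hrep⟩ := exists_repetition ρ c
    have hcard : 0 < Fintype.card V := Fintype.card_pos_iff.2 ⟨v₀⟩
    have hdich : ∀ i, G.cost i ρ ≤ p ∨
        ((p + d + Fintype.card V : ℕ) : ℕ∞) ≤ G.cost i ρ := by
      intro i
      rcases lt_or_ge (G.cost i ρ) (G.cost i₀ ρ) with hi | hi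
      · exact Or.inl ((hgap i hi).trans (by exact_mod_cast hcp))
      · refine Or.inr (le_trans ?_ hi)
        rw [hc]
        exact_mod_cast (by omega)
    have h₁ : ∀ n ≤ p, (fun n => if n ≤ p then ρ n else ρ (n + d)) n = ρ n :=
      fun n hn => if_pos hn
    have h₂ : ∀ n > p, (fun n => if n ≤ p then ρ n else ρ (n + d)) n = ρ (n + d) :=
      fun n hn => if_neg (by omega)
    have hlt₀ : (p : ℕ∞) < G.cost i₀ ρ := by
      rw [hc]
      exact_mod_cast (by omega)
    have hfin₀ : G.cost i₀ ρ ≠ ⊤ := by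
      rw [hc]
      exact ENat.natCast_ne_top _
    have hsus := h.remove_cycle G h0 hE hd hrep hdich ⟨i₀, hlt₀, hfin₀⟩ h₁ h₂
    generalize (fun n => if n ≤ p then ρ n else ρ (n + d)) = ρ' at h₁ h₂ hsus
    have hadd : ∀ i, p < G.cost i ρ → G.cost i ρ = G.cost i ρ' + d := fun i hi =>
      G.cost_eq_add_of_remove h₁ h₂ fun n hn hF => by
        have h1 := ((hdich i).resolve_left (not_le.2 hi)).trans (G.cost_le hF)
        have h2 : p + d + Fintype.card V ≤ n := by exact_mod_cast h1
        omega
    have hle : ∀ i, G.cost i ρ' ≤ G.cost i ρ := by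
      intro i
      rcases le_or_gt (G.cost i ρ) p with hi | hi
      · exact (G.cost_eq_of_remove_of_le h₁ hi).le
      · rw [hadd i hi]
        exact le_self_add
    have hE' : ∀ n, G.E (ρ' n) (ρ' (n + 1)) := by
      intro n
      rcases lt_trichotomy n p with hn | rfl | hn
      · rw [h₁ n hn.le, h₁ (n + 1) hn]
        exact hE n
      · rw [h₁ n le_rfl, h₂ (n + 1) (by omega), ← hrep, show n + 1 + d = n + d + 1 by omega]
        exact hE _
      · rw [h₂ n hn, h₂ (n + 1) (by omega), show n + 1 + d = n + d + 1 by omega]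
        exact hE _
    have hsum : ∑ i, (G.cost i ρ').toNat < ∑ i, (G.cost i ρ).toNat := by
      refine Finset.sum_lt_sum (fun i _ => ?_) ⟨i₀, Finset.mem_univ _, ?_⟩
      · by_cases htop : G.cost i ρ = ⊤
        · have hpi : (p : ℕ∞) < G.cost i ρ := by
            rw [htop]
            exact ENat.natCast_lt_top p
          have h1 := hadd i hpi
          rw [htop] at h1
          have h2 : G.cost i ρ' = ⊤ := by
            by_contra hne
            obtain ⟨m, hm⟩ := ENat.ne_top_iff_exists.1 hne
            rw [← hm] at h1
            exact ENat.natCast_ne_top (m + d) (by exact_mod_cast h1.symm)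
          rw [htop, h2]
        · exact ENat.toNat_le_toNat (hle i) htop
      · obtain ⟨m, hm⟩ := ENat.ne_top_iff_exists.1 (ne_top_of_le_ne_top hfin₀ (hle i₀))
        rw [hadd i₀ hlt₀, ← hm, ← Nat.cast_add, ENat.toNat_natCast, ENat.toNat_natCast]
        omega
    obtain ⟨ρ'', h0'', hsus'', hb, hle''⟩ :=
      ih _ (hN ▸ hsum) hsus (by rw [h₁ 0 (by omega), h0]) hE' rfl
    exact ⟨ρ'', h0'', hsus'', hb, fun i => (hle'' i).trans (hle i)⟩

end Optimality

end QRGame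

/-- If there exists a secure equilibrium with cost profile `(a_i)` in
`(G, v₀)`, then there exists a goal-optimal (with bound `Γ = 2·|Π|·|V|`) and
dev-optimal secure equilibrium in `(G, v₀)` whose cost profile `(b_i)`
satisfies `b_i ≤ a_i` for every player `i`. -/
theorem exists_goal_and_dev_optimal_secure_equilibrium_smaller_costs
    {ι V : Type} [Fintype ι] [Fintype V] [DecidableEq ι]
    (G : QRGame ι V) (v₀ : V) (Γ : ℕ)
    (hΓ : Γ = 2 * Fintype.card ι * Fintype.card V)
    (σ : ι → List V → V) (hprof : G.IsProfile v₀ σ) (hsec : G.IsSecure v₀ σ)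
    (a : ι → ℕ∞) (ha : ∀ i, a i = G.cost i (G.outcome v₀ σ)) :
    ∃ τ : ι → List V → V, G.IsProfile v₀ τ ∧ G.IsSecure v₀ τ ∧
      G.GoalOpt v₀ τ Γ ∧ G.DevOpt v₀ τ ∧
      ∀ i, G.cost i (G.outcome v₀ τ) ≤ a i := by
  obtain ⟨ρ, h0, hsus, hgoal, hle⟩ :=
    (hsec.sustains G hprof).exists_goal_bounded G (QRGame.outcome_zero ..) (G.outcome_edge hprof)
  have hsup : (⨆ i ∈ {i : ι | G.cost i ρ ≠ ⊤}, G.cost i ρ) ≠ ⊤ :=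
    ne_top_of_le_ne_top
      (ENat.natCast_ne_top (2 * Fintype.card ι * Fintype.card V))
      (iSup₂_le fun i hi => (hgoal i hi).le)
  have hM : ∀ i, G.cost i ρ ≠ ⊤ →
      G.cost i ρ ≤ (⨆ i ∈ {i : ι | G.cost i ρ ≠ ⊤}, G.cost i ρ).toNat := by
    intro i hi
    rw [ENat.natCast_toNat hsup]
    exact le_iSup₂ (f := fun i (_ : i ∈ {i : ι | G.cost i ρ ≠ ⊤}) => G.cost i ρ) i hi
  obtain ⟨τ, hτ, hout, hdev⟩ := (hsus.noGain_costLT G hM).exists_profile G h0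
  refine ⟨τ, hτ, ?_, ?_, ?_, fun i => ?_⟩
  · rintro ⟨j, σ', hσ', hprec⟩
    refine (hdev j σ' hσ').1 ?_
    rw [← hout]
    exact hprec
  · intro i
    rw [hout, hΓ]
    exact hgoal i
  · intro j σ' hσ'
    rw [hout]
    exact (hdev j σ' hσ').2
  · rw [hout, ha]
    exact hle i
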